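/- For every integer k ≥ 1 and every dimension d ≥ 2 there exist nonempty bounded convex open sets Ω₁ ⊆ Ω₂ ⊂ ℝ^d with μ_k(Ω₁) < μ_k(Ω₂); that is, domain monotonicity of the k-th Neumann eigenvalue fails among bounded convex domains in every dimension d ≥ 2 (equivalently, α_{k,d} < 1). -/

import Mathlib

open MeasureTheory Real Filter

noncomputable section

/-- Euclidean space `ℝ^d`. -/
abbrev Euc (d : ℕ) := EuclideanSpace ℝ (Fin d)

/-- The Rayleigh quotient of a function `u` on a set `Ω ⊆ ℝ^d`. -/
noncomputable def rayleigh {d : ℕ} (Ω : Set (Euc d)) (u : Euc d → ℝ) : ℝ :=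
  (∫ x in Ω, ‖fderiv ℝ u x‖ ^ 2) / (∫ x in Ω, (u x) ^ 2)

/-- The `k`-th Neumann eigenvalue of `Ω ⊆ ℝ^d`, defined by the variational (min-max)
principle: the infimum, over all subspaces `V` of smooth functions `ℝ^d → ℝ` whose space of
restrictions to `Ω` is `(k+1)`-dimensional, of the supremum of the Rayleigh quotient over
the elements of `V` that are nonzero in `L²(Ω)`. -/
noncomputable def neumannEigenvalue {d : ℕ} (k : ℕ) (Ω : Set (Euc d)) : ℝ :=
  sInf { t : ℝ | ∃ V : Submodule ℝ (Euc d → ℝ),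
    (∀ u ∈ V, ContDiff ℝ (⊤ : ℕ∞) u) ∧
    Module.finrank ℝ (V.map (LinearMap.funLeft ℝ ℝ ((↑) : Ω → Euc d))) = k + 1 ∧
    t = sSup { r : ℝ | ∃ u ∈ V, (0 < ∫ x in Ω, (u x) ^ 2) ∧ r = rayleigh Ω u } }

/-- A nonempty bounded convex open subset of `ℝ^d`. -/
def IsConvexDomain {d : ℕ} (Ω : Set (Euc d)) : Prop :=
  Ω.Nonempty ∧ IsOpen Ω ∧ Bornology.IsBounded Ω ∧ Convex ℝ Ω

/-- The optimal constant `α_{k,d}`: the infimum of `μ_k(Ω₁)/μ_k(Ω₂)` over all pairs of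
nonempty bounded convex open sets `Ω₁ ⊆ Ω₂ ⊂ ℝ^d`. -/
noncomputable def alphaConst (k d : ℕ) : ℝ :=
  sInf { r : ℝ | ∃ Ω₁ Ω₂ : Set (Euc d), IsConvexDomain Ω₁ ∧ IsConvexDomain Ω₂ ∧ Ω₁ ⊆ Ω₂ ∧
    r = neumannEigenvalue k Ω₁ / neumannEigenvalue k Ω₂ }

/-- The Bessel function of the first kind of order `ν` (for `x > 0`). -/
noncomputable def besselJ (ν : ℝ) (x : ℝ) : ℝ :=
  ∑' m : ℕ, ((-1 : ℝ) ^ m / (m.factorial * Real.Gamma (m + ν + 1))) * (x / 2) ^ (2 * (m : ℝ) + ν)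

/-- The first positive zero `j_{ν,1}` of the Bessel function `J_ν`. -/
noncomputable def besselZero1 (ν : ℝ) : ℝ :=
  sInf {x : ℝ | 0 < x ∧ besselJ ν x = 0}

/-- The second positive zero `j_{ν,2}` of the Bessel function `J_ν`. -/
noncomputable def besselZero2 (ν : ℝ) : ℝ :=
  sInf {x : ℝ | besselZero1 ν < x ∧ besselJ ν x = 0}



lemma dirichlet_ineq {θ : ℝ} (h0 : 0 < θ) (hθ : θ < π) (a : ℝ) (w u : ℝ → ℝ) (hu : Continuous u)
    (hw : ∀ x, HasDerivAt w (u x) x) (ha : w a = 0) (hb : w (a+1) = 0) :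
    θ^2 * ∫ x in a..a+1, (w x)^2 ≤ ∫ x in a..a+1, (u x)^2 := by
  have hwc : Continuous w := continuous_iff_continuousAt.2 fun x => (hw x).continuousAt
  set φ : ℝ → ℝ := fun x => θ * (x - a - 1/2) with hφ
  have hφc : Continuous φ := by fun_prop
  have hcos : ∀ x ∈ Set.Icc a (a+1), 0 < cos (φ x) := by
    intro x hx
    apply cos_pos_of_mem_Ioo
    constructor <;> simp only [hφ] <;> nlinarith [hx.1, hx.2]
  have hle : a ≤ a + 1 := by linarith
  have hu' : Set.uIcc a (a+1) = Set.Icc a (a+1) := Set.uIcc_of_le hle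
  have hD : ∀ x ∈ Set.uIcc a (a+1), HasDerivAt (fun x => θ * tan (φ x) * (w x)^2)
      (((u x + θ * tan (φ x) * w x)^2 - ((u x)^2 - θ^2 * (w x)^2))) x := by
    intro x hx
    rw [hu'] at hx
    have hc := (hcos x hx).ne'
    have h1 : HasDerivAt φ θ x := by
      have := (((hasDerivAt_id x).sub_const a).sub_const (1/2)).const_mul θ
      simpa [hφ] using this
    have h2 := (((hasDerivAt_tan hc).comp x h1).const_mul θ).mul ((hw x).pow 2)
    refine HasDerivAt.congr_deriv (f := fun x => θ * tan (φ x) * (w x)^2) h2 ?_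
    simp only [Function.comp, Pi.pow_apply, tan_eq_sin_div_cos]
    field_simp
    have := sin_sq_add_cos_sq (φ x)
    have h3 : sin (φ x) ^2 = 1 - cos (φ x)^2 := by linarith
    push_cast
    ring_nf
    rw [h3]; ring
  have hcont : ContinuousOn (fun x => tan (φ x)) (Set.uIcc a (a+1)) := by
    rw [hu']
    intro x hx
    exact ((continuousAt_tan.2 (hcos x hx).ne').comp hφc.continuousAt).continuousWithinAt
  have hc1 : ContinuousOn (fun x => (u x + θ * tan (φ x) * w x)^2) (Set.uIcc a (a+1)) := by
    have := hu.continuousOn (s := Set.uIcc a (a+1))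
    have := hwc.continuousOn (s := Set.uIcc a (a+1))
    fun_prop
  have hi1 := hc1.intervalIntegrable (μ := volume)
  have hi2 : IntervalIntegrable (fun x => (u x)^2 - θ^2 * (w x)^2) volume a (a+1) :=
    Continuous.intervalIntegrable (by fun_prop) _ _
  have key := intervalIntegral.integral_eq_sub_of_hasDerivAt hD (hi1.sub hi2)
  rw [intervalIntegral.integral_sub hi1 hi2, intervalIntegral.integral_sub
    (Continuous.intervalIntegrable (by fun_prop) _ _)
    (Continuous.intervalIntegrable (by fun_prop) _ _), intervalIntegral.integral_const_mul, ha, hb] at key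
  have : 0 ≤ ∫ x in a..a+1, (u x + θ * tan (φ x) * w x)^2 :=
    intervalIntegral.integral_nonneg hle fun _ _ => sq_nonneg _
  simp at key
  linarith

lemma wirtinger0 {θ : ℝ} (h0 : 0 < θ) (hθ : θ < π) (a : ℝ) (u v : ℝ → ℝ) (hv : Continuous v)
    (hu : ∀ x, HasDerivAt u (v x) x) (hm : ∫ x in a..a+1, u x = 0) :
    θ^2 * ∫ x in a..a+1, (u x)^2 ≤ ∫ x in a..a+1, (v x)^2 := by
  have huc : Continuous u := continuous_iff_continuousAt.2 fun x => (hu x).continuousAt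
  have hle : a ≤ a + 1 := by linarith
  set w : ℝ → ℝ := fun x => ∫ t in a..x, u t with hw
  have hwd : ∀ x, HasDerivAt w (u x) x := fun x => huc.integral_hasStrictDerivAt a x |>.hasDerivAt
  have hwc : Continuous w := continuous_iff_continuousAt.2 fun x => (hwd x).continuousAt
  have ha : w a = 0 := by simp [hw]
  have hb : w (a+1) = 0 := hm
  have h1 := dirichlet_ineq h0 hθ a w u huc hwd ha hb
  have h2 := intervalIntegral.integral_deriv_mul_eq_sub (u := w) (v := u) (u' := u) (v' := v)
    (a := a) (b := a+1) (fun x _ => hwd x) (fun x _ => hu x)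
    (huc.intervalIntegrable _ _) (hv.intervalIntegrable _ _)
  rw [ha, hb, intervalIntegral.integral_add (Continuous.intervalIntegrable (by fun_prop) _ _)
    (Continuous.intervalIntegrable (by fun_prop) _ _)] at h2
  have h3 : 0 ≤ ∫ x in a..a+1, (v x + θ^2 * w x)^2 :=
    intervalIntegral.integral_nonneg hle fun _ _ => sq_nonneg _
  have h4 : ∫ x in a..a+1, (v x + θ^2 * w x)^2 = (∫ x in a..a+1, (v x)^2)
      + 2*θ^2 * (∫ x in a..a+1, w x * v x) + θ^4 * ∫ x in a..a+1, (w x)^2 := by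
    rw [← intervalIntegral.integral_const_mul, ← intervalIntegral.integral_const_mul,
      ← intervalIntegral.integral_add (Continuous.intervalIntegrable (by fun_prop) _ _)
      (Continuous.intervalIntegrable (by fun_prop) _ _), ← intervalIntegral.integral_add (Continuous.intervalIntegrable (by fun_prop) _ _)
      (Continuous.intervalIntegrable (by fun_prop) _ _)]
    congr 1; ext x; ring
  have h5 : ∫ x in a..a+1, u x * u x = ∫ x in a..a+1, (u x)^2 := by
    congr 1; ext x; ring
  rw [h5] at h2
  have h6 := mul_le_mul_of_nonneg_left h1 (sq_nonneg θ)
  nlinarith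

lemma wirtinger {θ : ℝ} (h0 : 0 < θ) (hθ : θ < π) (a : ℝ) (u v : ℝ → ℝ) (hv : Continuous v)
    (hu : ∀ x, HasDerivAt u (v x) x) :
    θ^2 * ((∫ x in a..a+1, (u x)^2) - (∫ x in a..a+1, u x)^2) ≤ ∫ x in a..a+1, (v x)^2 := by
  have huc : Continuous u := continuous_iff_continuousAt.2 fun x => (hu x).continuousAt
  set m := ∫ x in a..a+1, u x with hm
  have h := wirtinger0 h0 hθ a (fun x => u x - m) v hv (fun x => (hu x).sub_const m) (by
    rw [intervalIntegral.integral_sub (huc.intervalIntegrable _ _) (by simp)]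
    simp [hm])
  have : ∫ x in a..a+1, (u x - m)^2 = (∫ x in a..a+1, (u x)^2) - m^2 := by
    have : ∫ x in a..a+1, (u x - m)^2 = ∫ x in a..a+1, ((u x)^2 - (2*m)*(u x) + m^2) := by
      congr 1; ext x; ring
    rw [this, intervalIntegral.integral_add (Continuous.intervalIntegrable (by fun_prop) _ _)
      (Continuous.intervalIntegrable (by fun_prop) _ _), intervalIntegral.integral_sub (Continuous.intervalIntegrable (by fun_prop) _ _)
      (Continuous.intervalIntegrable (by fun_prop) _ _), intervalIntegral.integral_const_mul, ← hm]
    simp; ring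
  rwa [this] at h

lemma cons_cont {n : ℕ} : Continuous (fun z : ℝ × (Fin n → ℝ) => (Fin.cons z.1 z.2 : Fin (n+1) → ℝ)) := by
  refine continuous_pi fun i => ?_
  refine Fin.cases ?_ (fun j => ?_) i
  · simpa using continuous_fst
  · simp only [Fin.cons_succ]; fun_prop

lemma fubini_box {n : ℕ} (a b : Fin (n+1) → ℝ) (g : (Fin (n+1) → ℝ) → ℝ) (hg : Continuous g) :
    ∫ x in Set.Icc a b, g x =
      ∫ t in Set.Icc (a 0) (b 0), ∫ y in Set.Icc (Fin.tail a) (Fin.tail b), g (Fin.cons t y) := by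
  have hmp := (volume_preserving_piFinSuccAbove (fun _ : Fin (n+1) => ℝ) 0).symm
  have h1 := hmp.setIntegral_preimage_emb (MeasurableEquiv.measurableEmbedding _) g (Set.Icc a b)
  rw [← h1]
  have hpre : ((MeasurableEquiv.piFinSuccAbove (fun _ : Fin (n+1) => ℝ) 0).symm ⁻¹' Set.Icc a b)
      = Set.Icc (a 0) (b 0) ×ˢ Set.Icc (Fin.tail a) (Fin.tail b) := by
    ext ⟨t, y⟩
    simp [MeasurableEquiv.piFinSuccAbove, Set.mem_Icc, Pi.le_def, Fin.forall_fin_succ, Fin.tail]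
  rw [hpre, Measure.volume_eq_prod, setIntegral_prod]
  · simp [MeasurableEquiv.piFinSuccAbove, Fin.consEquiv]
  · rw [← Measure.volume_eq_prod]
    refine ContinuousOn.integrableOn_compact (isCompact_Icc.prod isCompact_Icc) ?_
    have := hg.comp (cons_cont (n := n))
    refine Continuous.continuousOn ?_
    convert this using 2
    simp [MeasurableEquiv.piFinSuccAbove, Fin.consEquiv]

lemma swap_box {n : ℕ} (a b : ℝ) (c d : Fin n → ℝ) (g : ℝ → (Fin n → ℝ) → ℝ)
    (hg : Continuous g.uncurry) :
    ∫ t in Set.Icc a b, ∫ y in Set.Icc c d, g t y = ∫ y in Set.Icc c d, ∫ t in Set.Icc a b, g t y := by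
  apply integral_integral_swap
  rw [Measure.prod_restrict, ← Measure.volume_eq_prod]
  exact ContinuousOn.integrableOn_compact (isCompact_Icc.prod isCompact_Icc) hg.continuousOn

lemma cint {n : ℕ} {c d : Fin n → ℝ} {f : (Fin n → ℝ) → ℝ} (hf : Continuous f) :
    Integrable f (volume.restrict (Set.Icc c d)) :=
  ContinuousOn.integrableOn_compact isCompact_Icc hf.continuousOn

lemma cint1 {c d : ℝ} {f : ℝ → ℝ} (hf : Continuous f) :
    Integrable f (volume.restrict (Set.Icc c d)) :=
  ContinuousOn.integrableOn_compact isCompact_Icc hf.continuousOn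

lemma efron {n : ℕ} (a : ℝ) (c : Fin n → ℝ) (g : ℝ → (Fin n → ℝ) → ℝ)
    (hg : Continuous g.uncurry) :
    (∫ t in Set.Icc a (a+1), (∫ y in Set.Icc c (c+1), g t y)^2)
      - (∫ t in Set.Icc a (a+1), ∫ y in Set.Icc c (c+1), g t y)^2
    ≤ (∫ y in Set.Icc c (c+1), ∫ t in Set.Icc a (a+1), (g t y)^2)
      - ∫ y in Set.Icc c (c+1), (∫ t in Set.Icc a (a+1), g t y)^2 := by
  set m : ℝ → ℝ := fun t => ∫ y in Set.Icc c (c+1), g t y with hm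
  set A : (Fin n → ℝ) → ℝ := fun y => ∫ t in Set.Icc a (a+1), g t y with hA
  have hgs : Continuous (Function.uncurry (fun y t => g t y)) := hg.comp continuous_swap
  have hmc : Continuous m := continuous_parametric_integral_of_continuous hg isCompact_Icc
  have hAc : Continuous A := continuous_parametric_integral_of_continuous hgs isCompact_Icc
  set M := ∫ t in Set.Icc a (a+1), m t with hM
  have hMA : ∫ y in Set.Icc c (c+1), A y = M := (swap_box a (a+1) c (c+1) g hg).symm
  have hg1 : ∀ t, Continuous (g t) := fun t => hg.comp (by fun_prop : Continuous fun y => (t, y))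
  have hg2 : ∀ y, Continuous (fun t => g t y) := fun y => hg.comp (by fun_prop : Continuous fun t => (t, y))
  have v1 : (volume.restrict (Set.Icc a (a+1))).real Set.univ = 1 := by simp
  have v2 : (volume.restrict (Set.Icc c (c+1))).real Set.univ = 1 := by
    simp [measureReal_def, Real.volume_Icc_pi]
  set P : ℝ := ∫ y in Set.Icc c (c+1), ∫ t in Set.Icc a (a+1), (g t y)^2 with hP
  have hsq : Continuous (fun y => ∫ t in Set.Icc a (a+1), (g t y)^2) := by
    refine continuous_parametric_integral_of_continuous (f := fun y t => (g t y)^2) ?_ isCompact_Icc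
    exact hgs.pow 2
  have hmg : Continuous (fun y => ∫ t in Set.Icc a (a+1), m t * g t y) := by
    refine continuous_parametric_integral_of_continuous (f := fun y t => m t * g t y) ?_ isCompact_Icc
    exact (hmc.comp continuous_snd).mul hgs
  have hmm : ∫ y in Set.Icc c (c+1), ∫ t in Set.Icc a (a+1), m t * g t y
      = ∫ t in Set.Icc a (a+1), (m t)^2 := by
    rw [← swap_box a (a+1) c (c+1) (fun t y => m t * g t y) ((hmc.comp continuous_fst).mul hg)]
    congr 1; ext t
    rw [integral_const_mul, sq]
  have key : 0 ≤ ∫ y in Set.Icc c (c+1), ∫ t in Set.Icc a (a+1), (g t y - m t - A y + M)^2 :=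
    integral_nonneg fun y => integral_nonneg fun t => sq_nonneg _
  have inner : ∀ y, ∫ t in Set.Icc a (a+1), (g t y - m t - A y + M)^2
      = (∫ t in Set.Icc a (a+1), (g t y)^2) - 2 * (∫ t in Set.Icc a (a+1), m t * g t y)
        + (∫ t in Set.Icc a (a+1), (m t)^2) - (A y)^2 + 2 * M * A y - M^2 := by
    intro y
    have h1 := hg2 y
    have e : ∀ t, (g t y - m t - A y + M)^2 = (g t y)^2 - 2 * (m t * g t y) + (m t)^2
       + 2 * (M - A y) * g t y - 2 * (M - A y) * m t + (M - A y)^2 := fun t => by ring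
    simp_rw [e]
    rw [integral_add (cint1 (by fun_prop)) (cint1 (by fun_prop)),
      integral_sub (cint1 (by fun_prop)) (cint1 (by fun_prop)),
      integral_add (cint1 (by fun_prop)) (cint1 (by fun_prop)),
      integral_add (cint1 (by fun_prop)) (cint1 (by fun_prop)),
      integral_sub (cint1 (by fun_prop)) (cint1 (by fun_prop)),
      integral_const_mul, integral_const_mul, integral_const_mul, integral_const, v1, ← hM]
    simp only [hA]
    simp only [smul_eq_mul]
    ring
  simp_rw [inner] at key
  rw [integral_sub (cint (by fun_prop)) (cint (by fun_prop)),
      integral_add (cint (by fun_prop)) (cint (by fun_prop)),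
      integral_sub (cint (by fun_prop)) (cint (by fun_prop)),
      integral_add (cint (by fun_prop)) (cint (by fun_prop)),
      integral_sub (cint (by fun_prop)) (cint (by fun_prop)),
      integral_const_mul, integral_const_mul, integral_const, integral_const, v2, hMA, hmm, ← hP] at key
  simp only [smul_eq_mul] at key
  linarith

lemma var_pi {θ : ℝ} (h0 : 0 < θ) (hθ : θ < π) (n : ℕ) : ∀ (a : Fin n → ℝ) (u : (Fin n → ℝ) → ℝ)
    (D : Fin n → (Fin n → ℝ) → ℝ) (_ : Continuous u) (_ : ∀ i, Continuous (D i))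
    (_ : ∀ x i t, HasDerivAt (fun t => u (Function.update x i t)) (D i (Function.update x i t)) t),
    θ^2 * ((∫ x in Set.Icc a (a+1), (u x)^2) - (∫ x in Set.Icc a (a+1), u x)^2)
      ≤ ∑ i, ∫ x in Set.Icc a (a+1), (D i x)^2 := by
  induction n with
  | zero =>
    intro a u D hu hD h
    have hv : (volume.restrict (Set.Icc a (a+1))).real Set.univ = 1 := by
      simp [measureReal_def, Real.volume_Icc_pi]
    have e : ∀ x, u x = u a := fun x => by rw [Subsingleton.elim x a]
    simp_rw [e]
    rw [integral_const, integral_const, hv]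
    simp
  | succ n ih =>
    intro a u D hu hD h
    have tl : Fin.tail (a + 1) = Fin.tail a + 1 := rfl
    have hc : ∀ g : (Fin (n+1) → ℝ) → ℝ, Continuous g →
      Continuous (Function.uncurry (fun t y => g (Fin.cons t y))) := fun g hg => hg.comp cons_cont
    have hcs : ∀ g : (Fin (n+1) → ℝ) → ℝ, Continuous g →
      Continuous (Function.uncurry (fun (y : Fin n → ℝ) (t : ℝ) => g (Fin.cons t y))) :=
      fun g hg => (hc g hg).comp continuous_swap
    have hp : ∀ g : (Fin (n+1) → ℝ) → ℝ, Continuous g →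
      Continuous (fun t => ∫ y in Set.Icc (Fin.tail a) (Fin.tail a + 1), g (Fin.cons t y)) :=
      fun g hg => continuous_parametric_integral_of_continuous (hc g hg) isCompact_Icc
    have hps : ∀ g : (Fin (n+1) → ℝ) → ℝ, Continuous g →
      Continuous (fun y : Fin n → ℝ => ∫ t in Set.Icc (a 0) (a 0 + 1), g (Fin.cons t y)) :=
      fun g hg => continuous_parametric_integral_of_continuous (hcs g hg) isCompact_Icc
    have FB : ∀ g : (Fin (n+1) → ℝ) → ℝ, Continuous g → ∫ x in Set.Icc a (a+1), g x =
      ∫ t in Set.Icc (a 0) (a 0 + 1), ∫ y in Set.Icc (Fin.tail a) (Fin.tail a + 1), g (Fin.cons t y) :=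
      fun g hg => by rw [fubini_box a (a+1) g hg, tl]; rfl
    have FBs : ∀ g : (Fin (n+1) → ℝ) → ℝ, Continuous g → ∫ x in Set.Icc a (a+1), g x =
      ∫ y in Set.Icc (Fin.tail a) (Fin.tail a + 1), ∫ t in Set.Icc (a 0) (a 0 + 1), g (Fin.cons t y) :=
      fun g hg => by rw [FB g hg]; exact swap_box _ _ _ _ _ (hc g hg)
    have hp2 : Continuous (fun t => (∫ y in Set.Icc (Fin.tail a) (Fin.tail a + 1), u (Fin.cons t y))^2) :=
      (hp u hu).pow 2
    have hps2 : Continuous (fun y : Fin n → ℝ => (∫ t in Set.Icc (a 0) (a 0 + 1), u (Fin.cons t y))^2) :=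
      (hps u hu).pow 2
    have hu2 : Continuous (fun x => (u x)^2) := by fun_prop
    have hD2 : ∀ i, Continuous (fun x => (D i x)^2) := fun i => (hD i).pow 2
    have A : ∀ t, θ^2 * ((∫ y in Set.Icc (Fin.tail a) (Fin.tail a + 1), (u (Fin.cons t y))^2)
        - (∫ y in Set.Icc (Fin.tail a) (Fin.tail a + 1), u (Fin.cons t y))^2)
        ≤ ∑ i : Fin n, ∫ y in Set.Icc (Fin.tail a) (Fin.tail a + 1), (D i.succ (Fin.cons t y))^2 := by
      intro t
      have hcy : Continuous (fun y : Fin n → ℝ => (Fin.cons t y : Fin (n+1) → ℝ)) :=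
        cons_cont.comp (by fun_prop : Continuous fun y : Fin n → ℝ => (t, y))
      refine ih (Fin.tail a) (fun y => u (Fin.cons t y)) (fun i y => D i.succ (Fin.cons t y))
        (hu.comp hcy) (fun i => (hD _).comp hcy) ?_
      intro x i s
      have := h (Fin.cons t x) i.succ s
      simpa [Fin.cons_update] using this
    have A' := integral_mono (μ := volume.restrict (Set.Icc (a 0) (a 0 + 1)))
      (cint1 (((hp _ hu2).sub hp2).const_mul (θ^2)))
      (cint1 (continuous_finsetSum _ fun i _ => hp _ (hD2 _))) A
    simp only [Pi.sub_apply] at A'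
    rw [integral_const_mul, integral_sub (cint1 (hp _ hu2)) (cint1 hp2),
      integral_finsetSum _ (fun i _ => cint1 (hp _ (hD2 _)))] at A'
    have B : ∀ y : Fin n → ℝ, θ^2 * ((∫ t in Set.Icc (a 0) (a 0 + 1), (u (Fin.cons t y))^2)
        - (∫ t in Set.Icc (a 0) (a 0 + 1), u (Fin.cons t y))^2)
        ≤ ∫ t in Set.Icc (a 0) (a 0 + 1), (D 0 (Fin.cons t y))^2 := by
      intro y
      have hcy : Continuous (fun t : ℝ => (Fin.cons t y : Fin (n+1) → ℝ)) :=
        cons_cont.comp (by fun_prop : Continuous fun t : ℝ => (t, y))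
      have hle : a 0 ≤ a 0 + 1 := by linarith
      have := wirtinger h0 hθ (a 0) (fun t => u (Fin.cons t y)) (fun t => D 0 (Fin.cons t y))
        ((hD 0).comp hcy) (fun t => by
          have := h (Fin.cons t y) 0 t
          simpa [Fin.update_cons_zero] using this)
      simpa only [intervalIntegral.integral_of_le hle, ← integral_Icc_eq_integral_Ioc] using this
    have B' := integral_mono (μ := volume.restrict (Set.Icc (Fin.tail a) (Fin.tail a + 1)))
      (cint (((hps _ hu2).sub hps2).const_mul (θ^2)))
      (cint (hps _ (hD2 0))) B
    simp only [Pi.sub_apply] at B'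
    rw [integral_const_mul, integral_sub (cint (hps _ hu2)) (cint hps2)] at B'
    have C := efron (a 0) (Fin.tail a) (fun t y => u (Fin.cons t y)) (hc _ hu)
    rw [← FB u hu, ← FBs _ hu2] at C
    rw [← FBs _ hu2, ← FBs _ (hD2 0)] at B'
    rw [← FB _ hu2] at A'
    have A3 : ∀ i : Fin n, ∫ t in Set.Icc (a 0) (a 0 + 1), ∫ y in Set.Icc (Fin.tail a) (Fin.tail a + 1), 
      (D i.succ (Fin.cons t y))^2 = ∫ x in Set.Icc a (a+1), (D i.succ x)^2 := fun i => (FB _ (hD2 _)).symm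
    simp_rw [A3] at A'
    rw [Fin.sum_univ_succ]
    have := mul_le_mul_of_nonneg_left C (sq_nonneg θ)
    linarith

lemma eint {d : ℕ} {Ω : Set (Euc d)} (hb : Bornology.IsBounded Ω) {f : Euc d → ℝ} (hf : Continuous f) :
    Integrable f (volume.restrict Ω) :=
  (ContinuousOn.integrableOn_compact hb.isCompact_closure hf.continuousOn).mono_set subset_closure

lemma int_sq_pos {d : ℕ} {Ω : Set (Euc d)} (ho : IsOpen Ω) (hb : Bornology.IsBounded Ω)
    {f : Euc d → ℝ} (hf : Continuous f) {x : Euc d} (hx : x ∈ Ω) (hfx : f x ≠ 0) :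
    0 < ∫ x in Ω, (f x)^2 := by
  refine lt_of_le_of_ne (integral_nonneg fun _ => sq_nonneg _) fun h => hfx ?_
  have h1 := (integral_eq_zero_iff_of_nonneg (fun _ => sq_nonneg _) (eint hb (hf.pow 2))).1 h.symm
  have h2 := Measure.eqOn_open_of_ae_eq h1 ho (hf.pow 2).continuousOn continuousOn_const hx
  simpa using h2

lemma eigen_lower {d k : ℕ} {Ω : Set (Euc d)} (ho : IsOpen Ω) (hb : Bornology.IsBounded Ω) {L : ℝ}
    (hne : ∃ V : Submodule ℝ (Euc d → ℝ),
    (∀ u ∈ V, ContDiff ℝ (⊤ : ℕ∞) u) ∧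
    Module.finrank ℝ (V.map (LinearMap.funLeft ℝ ℝ ((↑) : Ω → Euc d))) = k + 1)
    (H : ∀ u : Fin (k+1) → Euc d → ℝ, (∀ i, ContDiff ℝ (⊤ : ℕ∞) (u i)) →
      ∃ c : Fin (k+1) → ℝ, c ≠ 0 ∧ L * ∫ x in Ω, ((∑ i, c i • u i) x)^2 ≤
        ∫ x in Ω, ‖fderiv ℝ (∑ i, c i • u i) x‖^2) :
    L ≤ neumannEigenvalue k Ω := by
  unfold neumannEigenvalue
  apply le_csInf
  · obtain ⟨V, h1, h2⟩ := hne
    exact ⟨_, V, h1, h2, rfl⟩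
  rintro t ⟨V, hV, hfr, rfl⟩
  set ρ := LinearMap.funLeft ℝ ℝ ((↑) : Ω → Euc d) with hρ
  have : Module.Finite ℝ (V.map ρ) := Module.finite_of_finrank_pos (by omega)
  let bW := Module.finBasisOfFinrankEq ℝ (V.map ρ) hfr
  have hex : ∀ i, ∃ u ∈ V, ρ u = bW i := fun i => (bW i).2
  choose u huV hu using hex
  have hus : ∀ i, ContDiff ℝ (⊤ : ℕ∞) (u i) := fun i => hV _ (huV i)
  have huc : ∀ i, Continuous (u i) := fun i => (hus i).continuous
  have hud : ∀ i, Differentiable ℝ (u i) := fun i => (hus i).differentiable (by simp)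
  have hugc : ∀ i, Continuous (fderiv ℝ (u i)) := fun i => (hus i).continuous_fderiv (by simp)
  let U : (Fin (k+1) → ℝ) → Euc d → ℝ := fun c => ∑ i, c i • u i
  have hUV : ∀ c, U c ∈ V := fun c => Submodule.sum_mem _ fun i _ => V.smul_mem _ (huV i)
  have hUc : ∀ c, Continuous (U c) := fun c => (hV _ (hUV c)).continuous
  have hUg : ∀ c x, fderiv ℝ (U c) x = ∑ i, c i • fderiv ℝ (u i) x := by
    intro c x
    simp only [U]
    rw [fderiv_sum (fun i _ => (hud i x).const_smul (c i))]
    refine Finset.sum_congr rfl fun i _ => ?_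
    rw [fderiv_const_smul (hud i x)]
  have hUne : ∀ c, c ≠ 0 → 0 < ∫ x in Ω, (U c x)^2 := by
    intro c hc
    have h1 : ρ (U c) = ((∑ i, c i • bW i : V.map ρ) : Ω → ℝ) := by
      simp only [U, map_sum, map_smul, hu]
      simp
    have h2 : ρ (U c) ≠ 0 := by
      rw [h1]
      intro h
      apply hc
      have h3 : ∑ i, c i • bW i = 0 := Subtype.ext h
      exact funext fun i => Fintype.linearIndependent_iff.1 bW.linearIndependent c h3 i
    obtain ⟨x, hx⟩ := Function.ne_iff.1 h2
    exact int_sq_pos ho hb (hUc c) x.2 hx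
  set q : (Fin (k+1) → ℝ) → ℝ := fun c => ∫ x in Ω, (U c x)^2 with hq
  have hqe : q = fun c => ∑ i, ∑ j, (c i * c j) * ∫ x in Ω, u i x * u j x := by
    ext c
    simp only [hq, U]
    have : ∀ x, ((∑ i, c i • u i) x)^2 = ∑ i, ∑ j, (c i * c j) * (u i x * u j x) := by
      intro x
      simp only [Finset.sum_apply, Pi.smul_apply, smul_eq_mul, sq, Finset.sum_mul_sum]
      refine Finset.sum_congr rfl fun i _ => Finset.sum_congr rfl fun j _ => by ring
    simp_rw [this]
    have hci : ∀ i j, Continuous (fun x => (c i * c j) * (u i x * u j x)) := fun i j =>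
      continuous_const.mul ((huc i).mul (huc j))
    rw [integral_finsetSum _ (fun i _ => eint hb (continuous_finsetSum _ fun j _ => hci i j))]
    refine Finset.sum_congr rfl fun i _ => ?_
    rw [integral_finsetSum _ (fun j _ => eint hb (hci i j))]
    refine Finset.sum_congr rfl fun j _ => ?_
    rw [integral_const_mul]
  have hqc : Continuous q := by rw [hqe]; fun_prop
  have hqh : ∀ (r : ℝ) c, q (r • c) = r^2 * q c := by
    intro r c
    rw [hqe]
    simp only [Finset.mul_sum]
    refine Finset.sum_congr rfl fun i _ => Finset.sum_congr rfl fun j _ => by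
      simp only [Pi.smul_apply, smul_eq_mul]; ring
  obtain ⟨c0, hc0, hmin⟩ := (isCompact_sphere (0 : Fin (k+1) → ℝ) 1).exists_isMinOn
    (NormedSpace.sphere_nonempty.2 zero_le_one) hqc.continuousOn
  have hc0' : c0 ≠ 0 := by
    rintro rfl
    simp at hc0
  have hm : 0 < q c0 := hUne c0 hc0'
  have hql : ∀ c, q c0 * ‖c‖^2 ≤ q c := by
    intro c
    by_cases hc : c = 0
    · subst hc
      have : 0 ≤ q 0 := integral_nonneg fun _ => sq_nonneg _
      simpa using this
    · have hn : ‖c‖ ≠ 0 := norm_ne_zero_iff.2 hc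
      have h1 : q c0 ≤ q (‖c‖⁻¹ • c) := hmin (by simp [norm_smul, hn])
      rw [hqh] at h1
      have hp : 0 < ‖c‖^2 := by positivity
      calc q c0 * ‖c‖^2 ≤ (‖c‖⁻¹^2 * q c) * ‖c‖^2 := by gcongr
        _ = q c := by field_simp
  have hMex : ∀ i, ∃ C, ∀ x ∈ closure Ω, ‖fderiv ℝ (u i) x‖ ≤ C := fun i =>
    hb.isCompact_closure.exists_bound_of_continuousOn (hugc i).continuousOn
  choose M hM using hMex
  have hfin : volume Ω < ⊤ := hb.measure_lt_top
  have hgrad : ∀ c, ∫ x in Ω, ‖fderiv ℝ (U c) x‖^2 ≤ (∑ i, |M i|)^2 * volume.real Ω * ‖c‖^2 := by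
    intro c
    have h1 : ∀ x ∈ Ω, ‖fderiv ℝ (U c) x‖^2 ≤ (‖c‖ * ∑ i, |M i|)^2 := by
      intro x hx
      gcongr
      rw [hUg, Finset.mul_sum]
      refine (norm_sum_le _ _).trans (Finset.sum_le_sum fun i _ => ?_)
      rw [norm_smul]
      gcongr
      · exact norm_le_pi_norm c i
      · exact (hM i x (subset_closure hx)).trans (le_abs_self _)
    have h2 : Continuous (fun x => ‖fderiv ℝ (U c) x‖^2) :=
      (((hV _ (hUV c)).continuous_fderiv (by simp)).norm.pow 2)
    calc ∫ x in Ω, ‖fderiv ℝ (U c) x‖^2 ≤ ∫ x in Ω, (‖c‖ * ∑ i, |M i|)^2 :=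
          setIntegral_mono_on (eint hb h2) (eint hb continuous_const) ho.measurableSet h1
      _ = _ := by
        rw [setIntegral_const]; simp only [smul_eq_mul]; ring
  have hrep : ∀ v ∈ V, ∃ c, ∀ x ∈ Ω, v x = U c x := by
    intro v hv
    let w : V.map ρ := ⟨ρ v, Submodule.mem_map_of_mem hv⟩
    refine ⟨bW.repr w, fun x hx => ?_⟩
    have h1 := bW.sum_repr w
    have h2 := congrFun (congrArg Subtype.val h1) ⟨x, hx⟩
    have h3 : ((∑ i, bW.repr w i • bW i : V.map ρ) : Ω → ℝ) = ρ (U (bW.repr w)) := by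
      simp only [U, map_sum, map_smul, hu, Submodule.coe_sum, Submodule.coe_smul]
    rw [h3] at h2
    exact h2.symm
  have hbdd : BddAbove { r : ℝ | ∃ u ∈ V, (0 < ∫ x in Ω, (u x) ^ 2) ∧ r = rayleigh Ω u } := by
    refine ⟨(∑ i, |M i|)^2 * volume.real Ω / q c0, ?_⟩
    rintro r ⟨v, hv, hpos, rfl⟩
    obtain ⟨c, hc⟩ := hrep v hv
    have e1 : ∫ x in Ω, (v x)^2 = q c :=
      setIntegral_congr_fun ho.measurableSet fun x hx => by simp only [hc x hx]
    have e2 : ∫ x in Ω, ‖fderiv ℝ v x‖^2 = ∫ x in Ω, ‖fderiv ℝ (U c) x‖^2 :=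
      setIntegral_congr_fun ho.measurableSet fun x hx => by
        have : v =ᶠ[nhds x] U c := Filter.eventuallyEq_of_mem (ho.mem_nhds hx) hc
        simp only [this.fderiv_eq]
    unfold rayleigh
    rw [e1] at hpos
    rw [e1, e2, div_le_div_iff₀ hpos hm]
    have hK : 0 ≤ (∑ i, |M i|)^2 * volume.real Ω := by positivity
    calc (∫ x in Ω, ‖fderiv ℝ (U c) x‖^2) * q c0 ≤ (∑ i, |M i|)^2 * volume.real Ω * ‖c‖^2 * q c0 := by
          gcongr; exact hgrad c
      _ = (∑ i, |M i|)^2 * volume.real Ω * (q c0 * ‖c‖^2) := by ring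
      _ ≤ _ := by gcongr; exact hql c
  obtain ⟨c, hc, hle⟩ := H u hus
  have hpos := hUne c hc
  refine le_csSup_of_le hbdd ⟨U c, hUV c, hpos, rfl⟩ ?_
  unfold rayleigh
  rw [le_div_iff₀ hpos]
  exact hle

/-- The corner of the `j`-th unit cube. -/
def corner (n : ℕ) (j : ℝ) : Fin (n+1) → ℝ := Fin.cons j 0

lemma long_box {n : ℕ} (k : ℕ) (g : (Fin (n+1) → ℝ) → ℝ) (hg : Continuous g) :
    ∫ x in Set.Icc (0 : Fin (n+1) → ℝ) (Fin.cons (k:ℝ) 1), g x =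
      ∑ j ∈ Finset.range k, ∫ x in Set.Icc (corner n j) (corner n j + 1), g x := by
  have hG : Continuous (fun t : ℝ => ∫ y in Set.Icc (0 : Fin n → ℝ) 1, g (Fin.cons t y)) :=
    continuous_parametric_integral_of_continuous (f := fun t y => g (Fin.cons t y))
      (hg.comp cons_cont) isCompact_Icc
  have e : ∀ j : ℕ, ∫ x in Set.Icc (corner n j) (corner n j + 1), g x
      = ∫ t in (j:ℝ)..((j+1 : ℕ):ℝ), ∫ y in Set.Icc (0 : Fin n → ℝ) 1, g (Fin.cons t y) := by
    intro j
    rw [fubini_box _ _ g hg, intervalIntegral.integral_of_le (by push_cast; linarith),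
      ← integral_Icc_eq_integral_Ioc]
    have h1 : Fin.tail (corner n j) = 0 := by simp [corner]
    have h2 : Fin.tail (corner n j + 1) = 1 := by
      ext i; simp [corner, Fin.tail]
    rw [h1, h2]
    simp [corner]
  simp_rw [e]
  rw [intervalIntegral.sum_integral_adjacent_intervals (a := fun j : ℕ => (j:ℝ))
    (fun j _ => hG.intervalIntegrable _ _), fubini_box _ _ g hg,
    intervalIntegral.integral_of_le (by simp), ← integral_Icc_eq_integral_Ioc]
  have h1 : Fin.tail (0 : Fin (n+1) → ℝ) = 0 := rfl
  rw [h1]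
  simp

/-- The big box. -/
def bigBox (n k : ℕ) : Set (Euc (n+1)) :=
  WithLp.ofLp ⁻¹' (Set.pi Set.univ fun i => Set.Ioo 0 ((Fin.cons (k:ℝ) 1 : Fin (n+1) → ℝ) i))

lemma int_bigBox {n k : ℕ} (g : Euc (n+1) → ℝ) :
    ∫ x in bigBox n k, g x = ∫ x in Set.Icc (0 : Fin (n+1) → ℝ) (Fin.cons (k:ℝ) 1), g (WithLp.toLp 2 x) := by
  have h := (PiLp.volume_preserving_ofLp (Fin (n+1))).setIntegral_preimage_emb
    (MeasurableEquiv.toLp 2 (Fin (n+1) → ℝ)).symm.measurableEmbedding (fun x => g (WithLp.toLp 2 x))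
    (Set.pi Set.univ fun i => Set.Ioo 0 ((Fin.cons (k:ℝ) 1 : Fin (n+1) → ℝ) i))
  simp only [WithLp.toLp_ofLp] at h
  unfold bigBox
  rw [h]
  exact setIntegral_congr_set Measure.univ_pi_Ioo_ae_eq_Icc

lemma norm_dual_sq {n : ℕ} (l : Euc n →L[ℝ] ℝ) : ‖l‖^2 = ∑ i, (l (EuclideanSpace.single i 1))^2 := by
  set v := (InnerProductSpace.toDual ℝ (Euc n)).symm l with hv
  have h1 : ‖l‖ = ‖v‖ := by simp [hv]
  have h2 : ∀ i, l (EuclideanSpace.single i 1) = v i := by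
    intro i
    have : l (EuclideanSpace.single i 1) = inner ℝ v (EuclideanSpace.single i 1) := by
      rw [hv, InnerProductSpace.toDual_symm_apply]
    rw [this, EuclideanSpace.inner_single_right]; simp
  rw [h1, EuclideanSpace.norm_sq_eq]
  simp [h2]

lemma box_poincare {θ : ℝ} (h0 : 0 < θ) (hθ : θ < π) {n k : ℕ} (u : Euc (n+1) → ℝ)
    (hu : ContDiff ℝ (⊤ : ℕ∞) u)
    (hm : ∀ j < k, ∫ x in Set.Icc (corner n j) (corner n j + 1), u (WithLp.toLp 2 x) = 0) :
    θ^2 * ∫ x in bigBox n k, (u x)^2 ≤ ∫ x in bigBox n k, ‖fderiv ℝ u x‖^2 := by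
  have hto : Continuous (fun x : Fin (n+1) → ℝ => (WithLp.toLp 2 x : Euc (n+1))) :=
    PiLp.continuous_toLp 2 _
  have huc : Continuous (fun x : Fin (n+1) → ℝ => u (WithLp.toLp 2 x)) := hu.continuous.comp hto
  have hfc : Continuous (fderiv ℝ u) := hu.continuous_fderiv (by simp)
  have hDc : ∀ i, Continuous (fun x : Fin (n+1) → ℝ =>
      fderiv ℝ u (WithLp.toLp 2 x) (EuclideanSpace.single i 1)) := fun i =>
    (hfc.comp hto).clm_apply continuous_const
  have hd : ∀ (x : Fin (n+1) → ℝ) i t, HasDerivAt (fun t => u (WithLp.toLp 2 (Function.update x i t)))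
      (fderiv ℝ u (WithLp.toLp 2 (Function.update x i t)) (EuclideanSpace.single i 1)) t := by
    intro x i t
    have h1 : HasDerivAt (Function.update x i) (Pi.single i (1:ℝ)) t := hasDerivAt_update x i t
    have h2 := ((PiLp.continuousLinearEquiv 2 ℝ (fun _ : Fin (n+1) => ℝ)).symm.hasFDerivAt
      (x := Function.update x i t)).comp_hasDerivAt t h1
    have h3 := ((hu.differentiable (by simp)) (WithLp.toLp 2 (Function.update x i t))).hasFDerivAt
    exact h3.comp_hasDerivAt t h2
  have hu2 : Continuous (fun x : Fin (n+1) → ℝ => (u (WithLp.toLp 2 x))^2) := huc.pow 2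
  have hf2 : Continuous (fun x : Fin (n+1) → ℝ => ‖fderiv ℝ u (WithLp.toLp 2 x)‖^2) :=
    (hfc.comp hto).norm.pow 2
  rw [int_bigBox, int_bigBox, long_box _ _ hu2, long_box _ _ hf2, Finset.mul_sum]
  refine Finset.sum_le_sum fun j hj => ?_
  have := var_pi h0 hθ (n+1) (corner n j) _ _ huc hDc hd
  rw [hm j (Finset.mem_range.1 hj)] at this
  have e : ∀ x : Fin (n+1) → ℝ, ‖fderiv ℝ u (WithLp.toLp 2 x)‖^2
    = ∑ i, (fderiv ℝ u (WithLp.toLp 2 x) (EuclideanSpace.single i 1))^2 := fun x => norm_dual_sq _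
  simp_rw [e]
  have hD2 : ∀ i, Continuous (fun x : Fin (n+1) → ℝ =>
      (fderiv ℝ u (WithLp.toLp 2 x) (EuclideanSpace.single i 1))^2) := fun i => (hDc i).pow 2
  rw [integral_finsetSum _ (fun i _ => cint (hD2 i))]
  simpa using this

lemma bigBox_dom (n k : ℕ) (hk : 1 ≤ k) : IsConvexDomain (bigBox n k) := by
  have hpos : ∀ i, 0 < ((Fin.cons (k:ℝ) 1 : Fin (n+1) → ℝ) i) := by
    intro i
    refine Fin.cases ?_ (fun j => ?_) i
    · simp; omega
    · simp
  refine ⟨⟨WithLp.toLp 2 (fun i => (Fin.cons (k:ℝ) 1 : Fin (n+1) → ℝ) i / 2), ?_⟩, ?_, ?_, ?_⟩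
  · intro i _
    have := hpos i
    constructor
    · simp; linarith
    · simp; linarith
  · exact (isOpen_set_pi Set.finite_univ fun i _ => isOpen_Ioo).preimage (PiLp.continuous_ofLp 2 _)
  · have h1 : IsCompact ((fun x : Fin (n+1) → ℝ => (WithLp.toLp 2 x : Euc (n+1))) ''
      (Set.Icc (0 : Fin (n+1) → ℝ) (Fin.cons (k:ℝ) 1))) := isCompact_Icc.image (PiLp.continuous_toLp 2 _)
    refine h1.isBounded.subset fun x hx => ⟨x.ofLp, ?_, rfl⟩
    exact ⟨fun i => (hx i trivial).1.le, fun i => (hx i trivial).2.le⟩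
  · exact (convex_pi fun i _ => convex_Ioo _ _).linear_preimage
      (PiLp.continuousLinearEquiv 2 ℝ (fun _ : Fin (n+1) => ℝ)).toLinearMap

lemma bigBox_lower {θ : ℝ} (h0 : 0 < θ) (hθ : θ < π) {n k : ℕ} (hk : 1 ≤ k)
    (hne : ∃ V : Submodule ℝ (Euc (n+1) → ℝ),
    (∀ u ∈ V, ContDiff ℝ (⊤ : ℕ∞) u) ∧
    Module.finrank ℝ (V.map (LinearMap.funLeft ℝ ℝ ((↑) : bigBox n k → Euc (n+1)))) = k + 1) :
    θ^2 ≤ neumannEigenvalue k (bigBox n k) := by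
  obtain ⟨-, ho, hb, -⟩ := bigBox_dom n k hk
  refine eigen_lower ho hb hne ?_
  intro u hu
  let A : Matrix (Fin k) (Fin (k+1)) ℝ := fun j i =>
    ∫ x in Set.Icc (corner n j) (corner n j + 1), u i (WithLp.toLp 2 x)
  have hker : LinearMap.ker A.mulVecLin ≠ ⊥ := LinearMap.ker_ne_bot_of_finrank_lt (by simp)
  obtain ⟨c, hc, hc0⟩ := (Submodule.ne_bot_iff _).1 hker
  refine ⟨c, hc0, box_poincare h0 hθ _ ?_ ?_⟩
  · have : (∑ i, c i • u i) = fun x => ∑ i, c i * u i x := by ext x; simp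
    rw [this]
    exact ContDiff.sum fun i _ => contDiff_const.mul (hu i)
  · intro j hj
    have h1 := congrFun (LinearMap.mem_ker.1 hc) ⟨j, hj⟩
    have h2 : ∀ x : Fin (n+1) → ℝ, (∑ i, c i • u i) (WithLp.toLp 2 x) = ∑ i, c i * u i (WithLp.toLp 2 x) := by
      intro x; simp
    simp_rw [h2]
    have h3 : ∀ i, Continuous (fun x : Fin (n+1) → ℝ => c i * u i (WithLp.toLp 2 x)) := fun i =>
      continuous_const.mul ((hu i).continuous.comp (PiLp.continuous_toLp 2 _))
    rw [integral_finsetSum _ (fun i _ => cint (h3 i))]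
    simp_rw [integral_const_mul]
    simp_rw [mul_comm (c _)]
    exact h1

lemma int_cos_nat {ℓ : ℝ} (hℓ : 0 < ℓ) (n : ℤ) (hn : n ≠ 0) :
    ∫ s in (0:ℝ)..ℓ, cos (n * π / ℓ * s) = 0 := by
  have hn' : (n:ℝ) ≠ 0 := by exact_mod_cast hn
  have hc : (n * π / ℓ : ℝ) ≠ 0 := by positivity
  rw [intervalIntegral.integral_comp_mul_left (fun x => cos x) hc, integral_cos]
  have : n * π / ℓ * ℓ = n * π := by field_simp
  rw [this, sin_int_mul_pi]
  simp

/-- `∫ cos` over `[0, ℓ]`. -/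
def Cc (ℓ : ℝ) (n : ℤ) : ℝ := ∫ s in (0:ℝ)..ℓ, cos (n * π / ℓ * s)

lemma int_cos_cos (ℓ : ℝ) (i j : ℕ) :
    ∫ s in (0:ℝ)..ℓ, cos (i * π / ℓ * s) * cos (j * π / ℓ * s)
      = (Cc ℓ ((i:ℤ) - j) + Cc ℓ ((i:ℤ)+j)) / 2 := by
  unfold Cc
  rw [← intervalIntegral.integral_add (Continuous.intervalIntegrable (by fun_prop) _ _)
    (Continuous.intervalIntegrable (by fun_prop) _ _), ← intervalIntegral.integral_div]
  congr 1; ext s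
  push_cast
  have h1 : ((i:ℝ) - j) * π / ℓ * s = i * π / ℓ * s - j * π / ℓ * s := by ring
  have h2 : ((i:ℝ) + j) * π / ℓ * s = i * π / ℓ * s + j * π / ℓ * s := by ring
  rw [h1, h2, cos_sub, cos_add]; ring

lemma int_sin_sin (ℓ : ℝ) (i j : ℕ) :
    ∫ s in (0:ℝ)..ℓ, sin (i * π / ℓ * s) * sin (j * π / ℓ * s)
      = (Cc ℓ ((i:ℤ) - j) - Cc ℓ ((i:ℤ)+j)) / 2 := by
  unfold Cc
  rw [← intervalIntegral.integral_sub (Continuous.intervalIntegrable (by fun_prop) _ _)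
    (Continuous.intervalIntegrable (by fun_prop) _ _), ← intervalIntegral.integral_div]
  congr 1; ext s
  push_cast
  have h1 : ((i:ℝ) - j) * π / ℓ * s = i * π / ℓ * s - j * π / ℓ * s := by ring
  have h2 : ((i:ℝ) + j) * π / ℓ * s = i * π / ℓ * s + j * π / ℓ * s := by ring
  rw [h1, h2, cos_sub, cos_add]; ring

lemma Cc_zero (ℓ : ℝ) : Cc ℓ 0 = ℓ := by simp [Cc]

lemma Cc_nonneg {ℓ : ℝ} (hℓ : 0 < ℓ) (n : ℤ) : 0 ≤ Cc ℓ n := by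
  by_cases hn : n = 0
  · subst hn; rw [Cc_zero]; exact hℓ.le
  · exact (int_cos_nat hℓ n hn).ge

lemma int_sq_sum {k : ℕ} (ℓ : ℝ) (f : Fin (k+1) → ℝ → ℝ) (hf : ∀ i, Continuous (f i))
    (horth : ∀ i j, i ≠ j → ∫ s in (0:ℝ)..ℓ, f i s * f j s = 0) (b : Fin (k+1) → ℝ) :
    ∫ s in (0:ℝ)..ℓ, (∑ i, b i * f i s)^2 = ∑ i, (b i)^2 * ∫ s in (0:ℝ)..ℓ, f i s * f i s := by
  have e : ∀ s, (∑ i, b i * f i s)^2 = ∑ i, ∑ j, (b i * b j) * (f i s * f j s) := by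
    intro s
    simp only [sq, Finset.sum_mul_sum]
    exact Finset.sum_congr rfl fun i _ => Finset.sum_congr rfl fun j _ => by ring
  simp_rw [e]
  rw [intervalIntegral.integral_finsetSum (fun i _ => Continuous.intervalIntegrable (by fun_prop) _ _)]
  refine Finset.sum_congr rfl fun i _ => ?_
  rw [intervalIntegral.integral_finsetSum (fun i _ => Continuous.intervalIntegrable (by fun_prop) _ _)]
  simp_rw [intervalIntegral.integral_const_mul]
  rw [Finset.sum_eq_single i]
  · ring
  · intro j _ hj
    rw [horth i j hj.symm, mul_zero]
  · simp

lemma cos_orth {ℓ : ℝ} (hℓ : 0 < ℓ) {k : ℕ} (i j : Fin (k+1)) (h : i ≠ j) :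
    Cc ℓ (((i:ℕ):ℤ) - ((j:ℕ):ℤ)) = 0 ∧ Cc ℓ (((i:ℕ):ℤ) + ((j:ℕ):ℤ)) = 0 := by
  have h' : (i:ℕ) ≠ (j:ℕ) := fun h' => h (Fin.ext h')
  exact ⟨int_cos_nat hℓ _ (by omega), int_cos_nat hℓ _ (by omega)⟩

lemma int_f_sq {ℓ : ℝ} (hℓ : 0 < ℓ) {k : ℕ} (b : Fin (k+1) → ℝ) :
    ∫ s in (0:ℝ)..ℓ, (∑ i, b i * cos ((i:ℕ) * π / ℓ * s))^2
      = ∑ i, (b i)^2 * ((ℓ + Cc ℓ (((i:ℕ):ℤ)+((i:ℕ):ℤ)))/2) := by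
  rw [int_sq_sum ℓ (fun (i : Fin (k+1)) s => cos ((i:ℕ) * π / ℓ * s)) (fun i => by fun_prop)]
  · refine Finset.sum_congr rfl fun i _ => ?_
    rw [int_cos_cos, sub_self, Cc_zero]
  · intro i j h
    rw [int_cos_cos, (cos_orth hℓ i j h).1, (cos_orth hℓ i j h).2]; simp

lemma int_df_sq {ℓ : ℝ} (hℓ : 0 < ℓ) {k : ℕ} (b : Fin (k+1) → ℝ) :
    ∫ s in (0:ℝ)..ℓ, (∑ i, b i * sin ((i:ℕ) * π / ℓ * s))^2
      = ∑ i, (b i)^2 * ((ℓ - Cc ℓ (((i:ℕ):ℤ)+((i:ℕ):ℤ)))/2) := by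
  rw [int_sq_sum ℓ (fun (i : Fin (k+1)) s => sin ((i:ℕ) * π / ℓ * s)) (fun i => by fun_prop)]
  · refine Finset.sum_congr rfl fun i _ => ?_
    rw [int_sin_sin, sub_self, Cc_zero]
  · intro i j h
    rw [int_sin_sin, (cos_orth hℓ i j h).1, (cos_orth hℓ i j h).2]; simp

lemma cos_rayleigh {ℓ : ℝ} (hℓ : 0 < ℓ) {k : ℕ} (a : Fin (k+1) → ℝ) :
    ∫ s in (0:ℝ)..ℓ, (∑ i, (a i * ((i:ℕ) * π / ℓ)) * sin ((i:ℕ) * π / ℓ * s))^2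
      ≤ (k * π / ℓ)^2 * ∫ s in (0:ℝ)..ℓ, (∑ i, a i * cos ((i:ℕ) * π / ℓ * s))^2 := by
  rw [int_df_sq hℓ, int_f_sq hℓ, Finset.mul_sum]
  refine Finset.sum_le_sum fun i _ => ?_
  have h1 := Cc_nonneg hℓ (((i:ℕ):ℤ)+((i:ℕ):ℤ))
  have hi : ((i:ℕ):ℝ) ≤ k := by exact_mod_cast Nat.lt_succ_iff.1 i.2
  have h2 : (((i:ℕ):ℝ) * π / ℓ)^2 ≤ (k * π / ℓ)^2 := by gcongr
  rw [mul_pow]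
  calc a i ^ 2 * (((i:ℕ):ℝ) * π / ℓ)^2 * ((ℓ - Cc ℓ (((i:ℕ):ℤ)+((i:ℕ):ℤ)))/2)
      ≤ a i ^ 2 * (((i:ℕ):ℝ) * π / ℓ)^2 * ((ℓ + Cc ℓ (((i:ℕ):ℤ)+((i:ℕ):ℤ)))/2) := by
        gcongr; linarith
    _ ≤ a i ^ 2 * (k * π / ℓ)^2 * ((ℓ + Cc ℓ (((i:ℕ):ℤ)+((i:ℕ):ℤ)))/2) := by gcongr
    _ = _ := by ring

lemma cos_indep {ℓ : ℝ} (hℓ : 0 < ℓ) {k : ℕ} (a : Fin (k+1) → ℝ)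
    (h : ∫ s in (0:ℝ)..ℓ, (∑ i, a i * cos ((i:ℕ) * π / ℓ * s))^2 = 0) : ∀ i, a i = 0 := by
  rw [int_f_sq hℓ] at h
  have hw : ∀ i : Fin (k+1), 0 < (ℓ + Cc ℓ (((i:ℕ):ℤ)+((i:ℕ):ℤ)))/2 := fun i => by
    have h1 := Cc_nonneg hℓ (((i:ℕ):ℤ)+((i:ℕ):ℤ))
    linarith
  have h2 := (Finset.sum_eq_zero_iff_of_nonneg (fun i _ => mul_nonneg (sq_nonneg _) (hw i).le)).1 h
  intro i
  have := h2 i (Finset.mem_univ i)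
  rcases mul_eq_zero.1 this with h3 | h3
  · exact pow_eq_zero_iff (two_ne_zero) |>.1 h3
  · exact absurd h3 (ne_of_gt (hw i))

/-- Trial functions. -/
def trial {d : ℕ} (p e : Euc d) (ℓ : ℝ) (j : ℕ) : Euc d → ℝ :=
  fun x => cos (j * π / ℓ * inner ℝ e (x - p))

lemma trial_smooth {d : ℕ} (p e : Euc d) (ℓ : ℝ) (j : ℕ) : ContDiff ℝ (⊤ : ℕ∞) (trial p e ℓ j) := by
  unfold trial
  exact Real.contDiff_cos.comp (contDiff_const.mul (contDiff_const.inner ℝ (contDiff_id.sub contDiff_const)))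

lemma trial_grad {d k : ℕ} (p e : Euc d) (he : ‖e‖ = 1) (ℓ : ℝ) (a : Fin (k+1) → ℝ) (x : Euc d) :
    ‖fderiv ℝ (∑ i, a i • trial p e ℓ (i:ℕ)) x‖^2
      = (∑ i, (a i * ((i:ℕ) * π / ℓ)) * sin ((i:ℕ) * π / ℓ * inner ℝ e (x - p)))^2 := by
  have h1 : HasFDerivAt (fun x : Euc d => (inner ℝ e (x - p) : ℝ)) (innerSL ℝ e) x := by
    have := (innerSL ℝ e).hasFDerivAt (x := x - p)
    have h2 := this.comp x ((hasFDerivAt_id x).sub_const p)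
    rw [ContinuousLinearMap.comp_id] at h2
    exact h2
  set s : ℝ := inner ℝ e (x - p) with hs
  have h3 : HasDerivAt (fun s : ℝ => ∑ i : Fin (k+1), a i * cos ((i:ℕ) * π / ℓ * s))
      (∑ i : Fin (k+1), a i * (-sin ((i:ℕ) * π / ℓ * s) * ((i:ℕ) * π / ℓ))) s := by
    refine HasDerivAt.fun_sum fun i _ => ?_
    refine HasDerivAt.const_mul _ ?_
    have h4 : HasDerivAt (fun s : ℝ => ((i:ℕ):ℝ) * π / ℓ * s) ((i:ℕ) * π / ℓ) s := by
      simpa using (hasDerivAt_id s).const_mul (((i:ℕ):ℝ) * π / ℓ)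
    exact h4.cos
  have h5 := h3.comp_hasFDerivAt x h1
  have h6 : (∑ i, a i • trial p e ℓ (i:ℕ)) =
      (fun s : ℝ => ∑ i : Fin (k+1), a i * cos ((i:ℕ) * π / ℓ * s)) ∘ (fun x : Euc d => (inner ℝ e (x - p) : ℝ)) := by
    ext y; simp [trial]
  rw [h6, h5.fderiv, norm_smul, innerSL_apply_norm, he, mul_one, norm_eq_abs, sq_abs]
  rw [← neg_sq, ← Finset.sum_neg_distrib]
  congr 1
  refine Finset.sum_congr rfl fun i _ => by ring

lemma thin_upper {d k : ℕ} {Ω : Set (Euc d)} (hΩ : MeasurableSet Ω) (p e : Euc d) (he : ‖e‖ = 1) {ℓ c : ℝ}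
    (hℓ : 0 < ℓ) (hc : 0 < c)
    (hI : ∀ g : ℝ → ℝ, Continuous g → ∫ x in Ω, g (inner ℝ e (x - p)) = c * ∫ s in (0:ℝ)..ℓ, g s) :
    neumannEigenvalue k Ω ≤ (k * π / ℓ)^2 ∧ ∀ Ω' : Set (Euc d), Ω ⊆ Ω' →
      ∃ V : Submodule ℝ (Euc d → ℝ), (∀ u ∈ V, ContDiff ℝ (⊤ : ℕ∞) u) ∧
      Module.finrank ℝ (V.map (LinearMap.funLeft ℝ ℝ ((↑) : Ω' → Euc d))) = k + 1 := by
  set V : Submodule ℝ (Euc d → ℝ) := Submodule.span ℝ (Set.range fun i : Fin (k+1) => trial p e ℓ (i:ℕ)) with hV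
  have hrep : ∀ u ∈ V, ∃ a : Fin (k+1) → ℝ, ∑ i, a i • trial p e ℓ (i:ℕ) = u := fun u hu =>
    (Submodule.mem_span_range_iff_exists_fun ℝ).1 hu
  have hsm : ∀ u ∈ V, ContDiff ℝ (⊤ : ℕ∞) u := by
    intro u hu
    obtain ⟨a, rfl⟩ := hrep u hu
    have : (∑ i, a i • trial p e ℓ (i:ℕ)) = fun x => ∑ i, a i * trial p e ℓ (i:ℕ) x := by ext x; simp
    rw [this]
    exact ContDiff.sum fun i _ => contDiff_const.mul (trial_smooth p e ℓ i)
  have hsq : ∀ a : Fin (k+1) → ℝ, ∫ x in Ω, ((∑ i, a i • trial p e ℓ (i:ℕ)) x)^2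
      = c * ∫ s in (0:ℝ)..ℓ, (∑ i, a i * cos ((i:ℕ) * π / ℓ * s))^2 := by
    intro a
    rw [← hI (fun s => (∑ i, a i * cos ((i:ℕ) * π / ℓ * s))^2) (by fun_prop)]
    simp [trial]
  have hgr : ∀ a : Fin (k+1) → ℝ, ∫ x in Ω, ‖fderiv ℝ (∑ i, a i • trial p e ℓ (i:ℕ)) x‖^2
      = c * ∫ s in (0:ℝ)..ℓ, (∑ i, (a i * ((i:ℕ) * π / ℓ)) * sin ((i:ℕ) * π / ℓ * s))^2 := by
    intro a
    rw [← hI (fun s => (∑ i, (a i * ((i:ℕ) * π / ℓ)) * sin ((i:ℕ) * π / ℓ * s))^2) (by fun_prop)]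
    simp_rw [trial_grad p e he]
  have hfr : ∀ Ω' : Set (Euc d), Ω ⊆ Ω' →
      Module.finrank ℝ (V.map (LinearMap.funLeft ℝ ℝ ((↑) : Ω' → Euc d))) = k + 1 := by
    intro Ω' hsub
    rw [hV, Submodule.map_span, ← Set.range_comp, finrank_span_eq_card]
    · simp
    · rw [Fintype.linearIndependent_iff]
      intro a ha
      apply cos_indep hℓ
      have h0 : ∫ x in Ω, ((∑ i, a i • trial p e ℓ (i:ℕ)) x)^2 = 0 := by
        rw [setIntegral_congr_fun (g := fun _ => (0:ℝ)) hΩ]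
        · simp
        · intro x hx
          have := congrFun ha ⟨x, hsub hx⟩
          simp [LinearMap.funLeft] at this
          simp [this]
      rw [hsq] at h0
      exact (mul_eq_zero.1 h0).resolve_left hc.ne'
  refine ⟨?_, fun Ω' h => ⟨V, hsm, hfr Ω' h⟩⟩
  unfold neumannEigenvalue
  refine csInf_le_of_le ⟨0, ?_⟩ ⟨V, hsm, hfr Ω le_rfl, rfl⟩ ?_
  · rintro t ⟨V, -, -, rfl⟩
    apply Real.sSup_nonneg
    rintro r ⟨u, -, -, rfl⟩
    unfold rayleigh
    exact div_nonneg (integral_nonneg fun _ => by positivity) (integral_nonneg fun _ => sq_nonneg _)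
  · refine Real.sSup_le ?_ (sq_nonneg _)
    rintro r ⟨u, hu, hpos, rfl⟩
    obtain ⟨a, rfl⟩ := hrep u hu
    unfold rayleigh
    rw [div_le_iff₀ hpos, hsq, hgr]
    have := mul_le_mul_of_nonneg_left (cos_rayleigh hℓ a) hc.le
    linarith

lemma thin_exists {n : ℕ} {Ω : Set (Euc (n+1))} (hΩ : IsConvexDomain Ω) (p e : Euc (n+1)) (he : ‖e‖ = 1)
    {ℓ : ℝ} (hℓ : 0 < ℓ) (hseg : ∀ s ∈ Set.Icc 0 ℓ, p + s • e ∈ Ω) :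
    ∃ Ω₁ : Set (Euc (n+1)), IsConvexDomain Ω₁ ∧ Ω₁ ⊆ Ω ∧ ∃ c : ℝ, 0 < c ∧
      ∀ g : ℝ → ℝ, Continuous g → ∫ x in Ω₁, g (inner ℝ e (x - p)) = c * ∫ s in (0:ℝ)..ℓ, g s := by
  obtain ⟨-, ho, hb, -⟩ := hΩ
  have hK : IsCompact ((fun s : ℝ => p + s • e) '' Set.Icc 0 ℓ) := isCompact_Icc.image (by fun_prop)
  obtain ⟨r, hr, hthick⟩ := hK.exists_thickening_subset_open ho (by rintro _ ⟨s, hs, rfl⟩; exact hseg s hs)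
  set e0 : Euc (n+1) := EuclideanSpace.single 0 1 with he0
  have he0n : ‖e0‖ = 1 := by simp [he0]
  obtain ⟨R, hR⟩ : ∃ R : Euc (n+1) ≃ₗᵢ[ℝ] Euc (n+1), R e0 = e :=
    ⟨_, Submodule.reflection_sub (he0n.trans he.symm)⟩
  set δ : ℝ := r / (n+1) with hδ
  have hδ0 : 0 < δ := by positivity
  set lo : Fin (n+1) → ℝ := Fin.cons 0 (fun _ => -δ) with hlo
  set hi : Fin (n+1) → ℝ := Fin.cons ℓ (fun _ => δ) with hhi
  set P : Set (Fin (n+1) → ℝ) := Set.pi Set.univ fun i => Set.Ioo (lo i) (hi i) with hP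
  let h1 : Euc (n+1) ≃ₜ Euc (n+1) := (Homeomorph.subRight p).trans R.symm.toHomeomorph
  let h2 : Euc (n+1) ≃ₜ (Fin (n+1) → ℝ) :=
    h1.trans (PiLp.continuousLinearEquiv 2 ℝ (fun _ : Fin (n+1) => ℝ)).toHomeomorph
  have hh2 : ∀ x, h2 x = WithLp.ofLp (R.symm (x - p)) := fun x => rfl
  have hmp : MeasurePreserving h2 volume volume := by
    have a1 : MeasurePreserving (fun x : Euc (n+1) => x - p) volume volume :=
      measurePreserving_sub_right volume p
    exact (PiLp.volume_preserving_ofLp (Fin (n+1))).comp ((R.symm.measurePreserving).comp a1)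
  have hcoord : ∀ x, h2 x 0 = inner ℝ e (x - p) := by
    intro x
    rw [hh2, ← hR]
    have : (inner ℝ (R e0) (x - p) : ℝ) = inner ℝ e0 (R.symm (x - p)) := by
      rw [← R.inner_map_map e0 (R.symm (x - p))]; simp
    rw [this, he0, EuclideanSpace.inner_single_left]; simp
  refine ⟨h2 ⁻¹' P, ⟨?_, ?_, ?_, ?_⟩, ?_, (2*δ)^n, by positivity, ?_⟩
  · refine ⟨h2.symm (Fin.cons (ℓ/2) 0), ?_⟩
    rw [Set.mem_preimage, Homeomorph.apply_symm_apply]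
    intro i _
    refine Fin.cases ?_ (fun j => ?_) i
    · simp [hlo, hhi, hℓ]
    · simp [hlo, hhi, hδ0]
  · exact (isOpen_set_pi Set.finite_univ fun i _ => isOpen_Ioo).preimage h2.continuous
  · have hc : IsCompact (h2.symm '' (Set.Icc lo hi)) := isCompact_Icc.image h2.symm.continuous
    refine hc.isBounded.subset fun x hx => ⟨h2 x, ?_, h2.symm_apply_apply x⟩
    exact ⟨fun i => (hx i trivial).1.le, fun i => (hx i trivial).2.le⟩
  · intro x hx y hy a b ha hb hab
    have : h2 (a • x + b • y) = a • h2 x + b • h2 y := by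
      simp only [hh2]
      have e1 : a • x + b • y - p = a • (x - p) + b • (y - p) := by
        have : p = (a + b) • p := by rw [hab, one_smul]
        nth_rewrite 1 [this]
        module
      rw [e1]; simp
    rw [Set.mem_preimage, this]
    exact (convex_pi fun i _ => convex_Ioo _ _) hx hy ha hb hab
  · intro x hx
    apply hthick
    rw [Metric.mem_thickening_iff]
    set y := R.symm (x - p) with hy
    have hy0 : y 0 ∈ Set.Ioo 0 ℓ := by
      have h := hx 0 trivial
      have h' : lo 0 < y 0 ∧ y 0 < hi 0 := by
        rw [hy, ← hh2]; exact h
      exact h'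
    have hyj : ∀ j : Fin n, y j.succ ∈ Set.Ioo (-δ) δ := by
      intro j
      have h := hx j.succ trivial
      have h' : lo j.succ < y j.succ ∧ y j.succ < hi j.succ := by
        rw [hy, ← hh2]; exact h
      exact h'
    refine ⟨p + y 0 • e, ⟨y 0, ⟨hy0.1.le, hy0.2.le⟩, rfl⟩, ?_⟩
    have e1 : x - (p + y 0 • e) = R (y - y 0 • e0) := by
      rw [map_sub, map_smul, hR, hy, R.apply_symm_apply]; abel
    rw [dist_eq_norm, e1, R.norm_map]
    refine lt_of_pow_lt_pow_left₀ 2 hr.le ?_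
    rw [EuclideanSpace.norm_sq_eq, Fin.sum_univ_succ]
    have e2 : ∀ j : Fin n, ‖(y - y 0 • e0) j.succ‖^2 ≤ δ^2 := by
      intro j
      have := hyj j
      simp [he0]
      exact sq_le_sq' this.1.le this.2.le
    have e3 : ‖(y - y 0 • e0) 0‖^2 = 0 := by simp [he0]
    have e4 := Finset.sum_le_sum (s := Finset.univ) fun j (_ : j ∈ Finset.univ) => e2 j
    rw [Finset.sum_const, Finset.card_univ, Fintype.card_fin, nsmul_eq_mul] at e4
    rw [e3, zero_add]
    refine e4.trans_lt ?_
    rw [hδ, div_pow, mul_div_assoc', div_lt_iff₀ (by positivity)]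
    have : (0:ℝ) ≤ n := by positivity
    have h3 : 0 < r^2 := by positivity
    have h4 : (n:ℝ) < (n+1)^2 := by nlinarith
    nlinarith [mul_lt_mul_of_pos_left h4 h3]
  · intro g hg
    have e1 := hmp.setIntegral_preimage_emb h2.measurableEmbedding (fun y => g (y 0)) P
    simp only [hcoord] at e1
    have e2 : ∫ y in P, g (y 0) = ∫ y in Set.Icc lo hi, g (y 0) :=
      setIntegral_congr_set Measure.univ_pi_Ioo_ae_eq_Icc
    rw [e1, e2, fubini_box lo hi (fun y => g (y 0)) (by fun_prop),
      intervalIntegral.integral_of_le hℓ.le, ← integral_Icc_eq_integral_Ioc]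
    have hv : volume.real (Set.Icc (Fin.tail lo) (Fin.tail hi)) = (2*δ)^n := by
      rw [measureReal_def, Real.volume_Icc_pi_toReal]
      · simp [hlo, hhi, two_mul]
      · intro i; simp [hlo, hhi]; linarith
    simp only [Fin.cons_zero, setIntegral_const, hv, smul_eq_mul, integral_const_mul]
    simp [hlo, hhi]

/-- domain monotonicity of the `k`-th Neumann eigenvalue fails among bounded
convex domains in every dimension `d ≥ 2`; equivalently `α_{k,d} < 1`. -/
theorem monotonicity_fails
    (k d : ℕ) (hk : 1 ≤ k) (hd : 2 ≤ d) :
    (∃ Ω₁ Ω₂ : Set (Euc d), IsConvexDomain Ω₁ ∧ IsConvexDomain Ω₂ ∧ Ω₁ ⊆ Ω₂ ∧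
      neumannEigenvalue k Ω₁ < neumannEigenvalue k Ω₂) ∧
    alphaConst k d < 1 := by
  have hnn : ∀ Ω : Set (Euc d), 0 ≤ neumannEigenvalue k Ω := by
    intro Ω
    apply Real.sInf_nonneg
    rintro t ⟨V, -, -, rfl⟩
    apply Real.sSup_nonneg
    rintro r ⟨u, -, -, rfl⟩
    exact div_nonneg (integral_nonneg fun _ => by positivity) (integral_nonneg fun _ => sq_nonneg _)
  have main : ∃ Ω₁ Ω₂ : Set (Euc d), IsConvexDomain Ω₁ ∧ IsConvexDomain Ω₂ ∧ Ω₁ ⊆ Ω₂ ∧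
      neumannEigenvalue k Ω₁ < neumannEigenvalue k Ω₂ := by
    obtain ⟨m, rfl⟩ : ∃ m, d = m + 1 + 1 := ⟨d - 2, by omega⟩
    have hk0 : (0:ℝ) < k := by exact_mod_cast hk
    set N : ℝ := √((k:ℝ)^2 + 1) with hN
    have hN2 : N^2 = (k:ℝ)^2 + 1 := Real.sq_sqrt (by positivity)
    have hN0 : 0 < N := Real.sqrt_pos.2 (by positivity)
    have hkN : (k:ℝ) < N := by nlinarith
    obtain ⟨ℓ, hℓ1, hℓ2⟩ := exists_between hkN
    have hℓ : 0 < ℓ := hk0.trans hℓ1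
    set e : Euc (m+1+1) := WithLp.toLp 2 (Fin.cons (k/N) (Fin.cons (1/N) 0)) with he
    have hen : ‖e‖ = 1 := by
      have : ‖e‖^2 = 1 := by
        rw [EuclideanSpace.norm_sq_eq, Fin.sum_univ_succ, Fin.sum_univ_succ]
        simp [he, abs_of_pos hN0]
        field_simp
        linarith
      rw [← Real.sqrt_sq (norm_nonneg e), this, Real.sqrt_one]
    set p : Euc (m+1+1) := WithLp.toLp 2 (Fin.cons ((k:ℝ)/2) (fun _ => 1/2)) - (ℓ/2) • e with hp
    have hseg : ∀ s ∈ Set.Icc 0 ℓ, p + s • e ∈ bigBox (m+1) k := by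
      intro s hs
      have hx : p + s • e = WithLp.toLp 2 (Fin.cons ((k:ℝ)/2) (fun _ => 1/2)) + (s - ℓ/2) • e := by
        rw [hp]; module
      rw [hx]
      have b1 : -(1/2) < (s - ℓ/2) / N := by
        rw [lt_div_iff₀ hN0]; linarith [hs.1]
      have b2 : (s - ℓ/2) / N < 1/2 := by
        rw [div_lt_iff₀ hN0]; linarith [hs.2]
      intro i _
      refine Fin.cases ?_ (fun j => ?_) i
      · have : (s - ℓ/2) * (k/N) = k * ((s - ℓ/2)/N) := by ring
        simp [he, this]
        constructor <;> nlinarith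
      · refine Fin.cases ?_ (fun j => ?_) j
        · have : (s - ℓ/2) * N⁻¹ = ((s - ℓ/2)/N) := by ring
          simp [he, this]
          constructor <;> linarith
        · simp [he]
          norm_num
    have hdom := bigBox_dom (m+1) k hk
    obtain ⟨Ω₁, hd1, hsub, c, hc, hI⟩ := thin_exists hdom p e hen hℓ hseg
    obtain ⟨hup, hV⟩ := thin_upper (k := k) hd1.2.1.measurableSet p e hen hℓ hc hI
    have hlt : k * π / ℓ < π := by
      rw [div_lt_iff₀ hℓ]; nlinarith [pi_pos]
    obtain ⟨θ, h1, h2⟩ := exists_between hlt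
    have hpos : 0 < k * π / ℓ := by positivity
    have hlow := bigBox_lower (hpos.trans h1) h2 hk (hV _ hsub)
    refine ⟨Ω₁, bigBox (m+1) k, hd1, hdom, hsub, hup.trans_lt (lt_of_lt_of_le ?_ hlow)⟩
    gcongr
  refine ⟨main, ?_⟩
  obtain ⟨Ω₁, Ω₂, h1, h2, h3, h4⟩ := main
  unfold alphaConst
  refine lt_of_le_of_lt (csInf_le ⟨0, ?_⟩ ⟨Ω₁, Ω₂, h1, h2, h3, rfl⟩) ?_
  · rintro r ⟨A, B, -, -, -, rfl⟩
    exact div_nonneg (hnn A) (hnn B)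
  · exact (div_lt_one ((hnn Ω₁).trans_lt h4)).2 h4

end
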